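/- Let f be an identical biarithmetic IASI with multiplier k of a finite simple graph G. In the total graph T(G), label each vertex v of G by f(v) and each edge e of G by f⁺(e). Then every vertex label and every edge label of T(G) under this labeling is an AP-set (i.e., the induced labeling of T(G) is an arithmetic labeling). -/

import Mathlib

open Pointwise

/-- A finite set of naturals is a `d`-AP-set if `d > 0`, it has at least 3 elements,
and its elements form an arithmetic progression with common difference `d`. -/
def IsAPSet (d : ℕ) (A : Finset ℕ) : Prop :=
  0 < d ∧ 3 ≤ A.card ∧ ∃ a : ℕ, A = (Finset.range A.card).image (fun i => a + i * d)

/-- An integer additive set-indexer (IASI) of a simple graph `G`: an injective labeling of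
vertices by nonempty finite sets of naturals whose induced edge labeling
`f⁺(uv) = f(u) + f(v)` (sumset) is injective on edges. -/
structure IsIASI {V : Type*} (G : SimpleGraph V) (f : V → Finset ℕ) : Prop where
  injective : Function.Injective f
  nonempty : ∀ v, (f v).Nonempty
  edgeInjective : ∀ ⦃u v x y : V⦄, G.Adj u v → G.Adj x y →
    f u + f v = f x + f y → s(u, v) = s(x, y)

/-- A biarithmetic IASI of `G`: an IASI whose vertex labels are AP-sets with deterministic
indices `dv`, whose edge labels are AP-sets, and such that on each edge one deterministic
index is `k` times the other for some integer `k > 1` with `k` at most the cardinality of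
the label of the vertex with the smaller index. -/
def IsBiarithmeticIASI {V : Type*} (G : SimpleGraph V) (f : V → Finset ℕ)
    (dv : V → ℕ) : Prop :=
  IsIASI G f ∧ (∀ v, IsAPSet (dv v) (f v)) ∧
    (∀ u v, G.Adj u v → ∃ δ, IsAPSet δ (f u + f v)) ∧
    (∀ u v, G.Adj u v → ∃ k : ℕ, 1 < k ∧
      ((dv v = k * dv u ∧ k ≤ (f u).card) ∨ (dv u = k * dv v ∧ k ≤ (f v).card)))

/-- An identical biarithmetic IASI of `G` with multiplier `k`: a biarithmetic IASI in which
the same integer `k > 1` works for every edge. -/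
def IsIdenticalBiarithmeticIASI {V : Type*} (G : SimpleGraph V) (f : V → Finset ℕ)
    (dv : V → ℕ) (k : ℕ) : Prop :=
  IsIASI G f ∧ 1 < k ∧ (∀ v, IsAPSet (dv v) (f v)) ∧
    (∀ u v, G.Adj u v → ∃ δ, IsAPSet δ (f u + f v)) ∧
    (∀ u v, G.Adj u v →
      ((dv v = k * dv u ∧ k ≤ (f u).card) ∨ (dv u = k * dv v ∧ k ≤ (f v).card)))

lemma isAPSet_image_range {d n : ℕ} (hd : 0 < d) (hn : 3 ≤ n) (a : ℕ) :
    IsAPSet d ((Finset.range n).image fun i => a + i * d) := by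
  have hcard : ((Finset.range n).image fun i => a + i * d).card = n := by
    rw [Finset.card_image_of_injective, Finset.card_range]
    intro i j hij
    exact Nat.eq_of_mul_eq_mul_right hd (Nat.add_left_cancel hij)
  exact ⟨hd, hcard.symm ▸ hn, a, by rw [hcard]⟩

lemma image_range_add_image_range {k m n : ℕ} (hk : 0 < k) (hkm : k ≤ m) (hn : 0 < n)
    (a b d : ℕ) :
    ((Finset.range m).image fun i => a + i * d) +
        ((Finset.range n).image fun i => b + i * (k * d)) =
      (Finset.range (m + k * (n - 1))).image fun i => (a + b) + i * d := by
  ext x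
  simp only [Finset.mem_add, Finset.mem_image, Finset.mem_range]
  constructor
  · rintro ⟨_, ⟨p, hp, rfl⟩, _, ⟨q, hq, rfl⟩, rfl⟩
    have hle : k * q ≤ k * (n - 1) := Nat.mul_le_mul_left k (by omega)
    exact ⟨p + k * q, by omega, by ring⟩
  · rintro ⟨i, hi, rfl⟩
    obtain ⟨p, q, hp, hq, rfl⟩ : ∃ p q, p < m ∧ q < n ∧ i = p + k * q := by
      rcases lt_or_ge (i / k) n with hlt | hge
      · exact ⟨i % k, i / k, (Nat.mod_lt i hk).trans_le hkm, hlt, (Nat.mod_add_div i k).symm⟩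
      · have hle : k * (n - 1) ≤ i :=
          (Nat.mul_le_mul_left k (by omega)).trans (Nat.mul_div_le i k)
        exact ⟨i - k * (n - 1), n - 1, by omega, by omega, by omega⟩
    exact ⟨_, ⟨p, hp, rfl⟩, _, ⟨q, hq, rfl⟩, by ring⟩

lemma IsAPSet.add {d k : ℕ} {A B : Finset ℕ} (hA : IsAPSet d A) (hB : IsAPSet (k * d) B)
    (hk : k ≤ A.card) : IsAPSet d (A + B) := by
  obtain ⟨hd, hA3, a, ha⟩ := hA
  obtain ⟨hkd, hB3, b, hb⟩ := hB
  have hsum := image_range_add_image_range (Nat.pos_of_mul_pos_right hkd) hk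
    (by omega : 0 < B.card) a b d
  rw [← ha, ← hb] at hsum
  rw [hsum]
  exact isAPSet_image_range hd (by omega) _

lemma IsAPSet.add_same {d : ℕ} {A B : Finset ℕ} (hA : IsAPSet d A) (hB : IsAPSet d B) :
    IsAPSet d (A + B) :=
  hA.add (k := 1) (by rwa [one_mul]) (by have := hA.2.1; omega)

lemma IsAPSet.le_card_add {d k : ℕ} {A B : Finset ℕ} (hB : IsAPSet d B)
    (hk : k ≤ A.card) : k ≤ (A + B).card :=
  hk.trans (Finset.card_le_card_add_right (Finset.card_pos.1 (by have := hB.2.1; omega)))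

/-- For an identical biarithmetic IASI `f` of `G` with multiplier `k`, the induced
labeling of the total graph `T(G)` (vertices of `G` get `f(v)`, edges of `G` get `f⁺(e)`)
is arithmetic: every vertex label and every edge label of `T(G)` is an AP-set. -/
theorem stmt15 {V : Type*} [Fintype V] (G : SimpleGraph V)
    (f : V → Finset ℕ) (dv : V → ℕ) (k : ℕ)
    (h : IsIdenticalBiarithmeticIASI G f dv k) :
    (∀ v, ∃ δ, IsAPSet δ (f v)) ∧
    (∀ x y, G.Adj x y → ∃ δ, IsAPSet δ (f x + f y)) ∧
    (∀ u v, G.Adj u v → ∃ δ, IsAPSet δ (f u + f v)) ∧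
    (∀ a b c, G.Adj a b → G.Adj b c → s(a, b) ≠ s(b, c) →
      ∃ δ, IsAPSet δ ((f a + f b) + (f b + f c))) ∧
    (∀ v x y, G.Adj x y → (v = x ∨ v = y) → ∃ δ, IsAPSet δ (f v + (f x + f y))) := by
  obtain ⟨-, -, hv, he, hk⟩ := h
  refine ⟨fun v => ⟨_, hv v⟩, he, he, ?_, ?_⟩
  · intro a b c hab hbc _
    have hva := hv a
    have hvb := hv b
    have hvc := hv c
    rcases hk a b hab with ⟨h₁, hc₁⟩ | ⟨h₁, hc₁⟩ <;>
      rcases hk b c hbc with ⟨h₂, hc₂⟩ | ⟨h₂, hc₂⟩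
    · rw [h₂] at hvc
      have hbc' := hvb.add hvc hc₂
      rw [h₁] at hvb hbc'
      exact ⟨_, (hva.add hvb hc₁).add hbc' (hvb.le_card_add hc₁)⟩
    · have hda : dv a = dv c :=
        Nat.eq_of_mul_eq_mul_left
          (Nat.pos_of_mul_pos_right (h₁ ▸ hvb.1)) (h₁.symm.trans h₂)
      rw [hda] at hva
      rw [h₂] at hvb
      have hab' := hva.add hvb hc₁
      rw [add_comm (f b)]
      exact ⟨_, hab'.add_same (hvc.add hvb hc₂)⟩
    · rw [h₁] at hva
      rw [h₂] at hvc
      rw [add_comm (f a)]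
      exact ⟨_, (hvb.add hva hc₁).add_same (hvb.add hvc hc₂)⟩
    · rw [h₁] at hva
      have hab' := hvb.add hva hc₁
      rw [h₂] at hvb hab'
      rw [add_comm (f a), add_comm (f b) (f c), add_comm]
      exact ⟨_, (hvc.add hvb hc₂).add hab' (hvb.le_card_add hc₂)⟩
  · have key : ∀ x y, dv y = k * dv x → k ≤ (f x).card → ∀ v, v = x ∨ v = y →
        IsAPSet (dv x) (f v + (f x + f y)) := by
      intro x y hxy hc v hvxy
      have hvy := hv y
      rw [hxy] at hvy
      have hsum := (hv x).add hvy hc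
      rcases hvxy with rfl | rfl
      · exact (hv v).add_same hsum
      · rw [add_comm]
        exact hsum.add hvy (hvy.le_card_add hc)
    intro v x y hxy hvxy
    rcases hk x y hxy with ⟨h₁, hc⟩ | ⟨h₁, hc⟩
    · exact ⟨_, key x y h₁ hc v hvxy⟩
    · rw [add_comm (f x)]
      exact ⟨_, key y x h₁ hc v hvxy.symm⟩
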